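/- arXiv:2506.13349 — 11 statements merged into one kernel-verified Lean document; each statement's English description precedes it below -/
import Mathlib

section
/- Let C be a category with a fixed class 𝒵 of zero objects. If f : A ⟶ B is a morphism, m : B ⟶ C is a monomorphism, and the composite m ∘ f belongs to the ideal N_𝒵, then f belongs to N_𝒵. -/
open CategoryTheory CategoryTheory.Limits

universe v u

/-- A class of zero objects in a category `C`: a collection of objects, closed under
isomorphism, such that every object has a zero part (a monomorphism from a zero object),
there is at most one morphism out of each zero object, and every morphism from a zero
object factors uniquely through any monic zero subobject of its codomain. -/
structure ZeroClass (C : Type u) [Category.{v} C] where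
  carrier : Set C
  repl : ∀ {A B : C}, A ∈ carrier → (A ≅ B) → B ∈ carrier
  zpart : C → C
  zpart_mem : ∀ A : C, zpart A ∈ carrier
  ε : ∀ A : C, zpart A ⟶ A
  ε_mono : ∀ A : C, Mono (ε A)
  hom_unique : ∀ {Z A : C}, Z ∈ carrier → ∀ f g : Z ⟶ A, f = g
  lift : ∀ {Z Z' A : C} (z : Z ⟶ A) (z' : Z' ⟶ A), Z ∈ carrier → Z' ∈ carrier → Mono z →
    ∃! φ : Z' ⟶ Z, φ ≫ z = z'

variable {C : Type u} [Category.{v} C]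

/-- The ideal `N_𝒵` of morphisms factoring through a zero object. -/
def InIdeal (zc : ZeroClass C) {A B : C} (f : A ⟶ B) : Prop :=
  ∃ (W : C) (g : A ⟶ W) (h : W ⟶ B), W ∈ zc.carrier ∧ g ≫ h = f

/-- `k` is a `𝒵`-kernel of `f`. -/
def IsZKernel (zc : ZeroClass C) {K A B : C} (k : K ⟶ A) (f : A ⟶ B) : Prop :=
  InIdeal zc (k ≫ f) ∧ ∀ {E : C} (e : E ⟶ A), InIdeal zc (e ≫ f) → ∃! φ : E ⟶ K, φ ≫ k = e

/-- `q` is a `𝒵`-cokernel of `f`. -/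
def IsZCokernel (zc : ZeroClass C) {A B Q : C} (q : B ⟶ Q) (f : A ⟶ B) : Prop :=
  InIdeal zc (f ≫ q) ∧ ∀ {P : C} (p : B ⟶ P), InIdeal zc (f ≫ p) → ∃! φ : Q ⟶ P, q ≫ φ = p

/-- `x : X ⟶ M` is a maximum quotient of `X` in `𝒵`. -/
def IsMaxQuotient (zc : ZeroClass C) {X M : C} (x : X ⟶ M) : Prop :=
  M ∈ zc.carrier ∧ ∀ {Z : C} (z : X ⟶ Z), Z ∈ zc.carrier → ∃ φ : M ⟶ Z, x ≫ φ = z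

/-- A morphism is inverted by the zero-part functor `Z` if the induced morphism between
zero parts is an isomorphism. -/
def InvertedByZ (zc : ZeroClass C) {A B : C} (h : A ⟶ B) : Prop :=
  ∃ φ : zc.zpart A ⟶ zc.zpart B, φ ≫ zc.ε B = zc.ε A ≫ h ∧ IsIso φ

/-- A `𝒵`-torsion theory, with chosen short `𝒵`-exact sequences. -/
structure ZTorsionTheory (zc : ZeroClass C) where
  tors : Set C
  torsFree : Set C
  tors_repl : ∀ {A B : C}, A ∈ tors → (A ≅ B) → B ∈ tors
  torsFree_repl : ∀ {A B : C}, A ∈ torsFree → (A ≅ B) → B ∈ torsFree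
  inter : zc.carrier = tors ∩ torsFree
  hom_triv : ∀ {T F : C}, T ∈ tors → F ∈ torsFree → ∀ f : T ⟶ F, InIdeal zc f
  tObj : C → C
  fObj : C → C
  tMem : ∀ A : C, tObj A ∈ tors
  fMem : ∀ A : C, fObj A ∈ torsFree
  t : ∀ A : C, tObj A ⟶ A
  η : ∀ A : C, A ⟶ fObj A
  t_ker : ∀ A : C, IsZKernel zc (t A) (η A)
  η_coker : ∀ A : C, IsZCokernel zc (η A) (t A)

/-- A class of morphisms of `C`. -/
def MorClass (C : Type u) [Category.{v} C] :=
  ∀ ⦃X Y : C⦄, (X ⟶ Y) → Prop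

/-- A class of morphisms is replete (closed under isomorphism in the arrow category). -/
def Replete (E : MorClass C) : Prop :=
  ∀ {A B A' B' : C} (e : A ⟶ B) (e' : A' ⟶ B') (α : A ≅ A') (β : B ≅ B'),
    α.hom ≫ e' = e ≫ β.hom → E e → E e'

/-- The unique diagonal lifting property `e ↓ m`. -/
def UniqueLift {A B X Y : C} (e : A ⟶ B) (m : X ⟶ Y) : Prop :=
  ∀ (u : A ⟶ X) (v : B ⟶ Y), e ≫ v = u ≫ m → ∃! d : B ⟶ X, e ≫ d = u ∧ d ≫ m = v

/-- A factorization system `(E, M)`. -/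
structure IsFactorizationSystem (E M : MorClass C) : Prop where
  E_repl : Replete E
  M_repl : Replete M
  lift : ∀ {A B X Y : C} (e : A ⟶ B) (m : X ⟶ Y), E e → M m → UniqueLift e m
  fac : ∀ {A B : C} (f : A ⟶ B), ∃ (I : C) (e : A ⟶ I) (m : I ⟶ B), E e ∧ M m ∧ e ≫ m = f

/-- `E` is stable under pullback along morphisms of the class `A'`. -/
def StableAlong (E A' : MorClass C) : Prop :=
  ∀ {P X Y W : C} (p : P ⟶ X) (e' : P ⟶ W) (e : X ⟶ Y) (a : W ⟶ Y),
    IsPullback p e' e a → E e → A' a → E e'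

/-- Condition (N). -/
def CondN (zc : ZeroClass C) (tt : ZTorsionTheory zc) : Prop :=
  ∀ {A B K : C} (f : A ⟶ B) (k : K ⟶ A), IsZKernel zc k f →
    ∃ (Q : C) (q : A ⟶ Q), IsZKernel zc (tt.t K ≫ k) q

/-- Condition (M). -/
def CondM (zc : ZeroClass C) (tt : ZTorsionTheory zc) : Prop :=
  ∀ {T A Q : C} (k : T ⟶ A) (q : A ⟶ Q), T ∈ tt.tors → IsZKernel zc k q →
    IsZCokernel zc q k → Nonempty (tt.fObj T ≅ zc.zpart Q)

/-- Condition (M'). -/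
def CondM' (zc : ZeroClass C) (tt : ZTorsionTheory zc) : Prop :=
  ∀ A : C, Nonempty (tt.fObj (tt.tObj A) ≅ zc.zpart (tt.fObj A))

/-- Condition (S). -/
def CondS (zc : ZeroClass C) (tt : ZTorsionTheory zc) : Prop :=
  ∀ {T T' Z' : C} (χ : T' ⟶ Z') (l : T' ⟶ T) (z : Z' ⟶ tt.fObj T),
    T ∈ tt.tors → Z' ∈ zc.carrier → IsPullback χ l z (tt.η T) →
    T' ∈ tt.tors ∧ IsZCokernel zc χ (𝟙 T')

/-- Condition (P): the reflector is `𝒵`-protoadditive, i.e. it preserves pullbacks of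
split epimorphisms along morphisms inverted by `Z`. -/
def CondP (zc : ZeroClass C) (tt : ZTorsionTheory zc) : Prop :=
  ∀ {P A D B : C} (p₁ : P ⟶ A) (p₂ : P ⟶ D) (f : A ⟶ B) (g : D ⟶ B),
    (∃ s : B ⟶ A, s ≫ f = 𝟙 B) → InvertedByZ zc g → IsPullback p₁ p₂ f g →
    ∀ (Fp₁ : tt.fObj P ⟶ tt.fObj A) (Fp₂ : tt.fObj P ⟶ tt.fObj D)
      (Ff : tt.fObj A ⟶ tt.fObj B) (Fg : tt.fObj D ⟶ tt.fObj B),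
      tt.η P ≫ Fp₁ = p₁ ≫ tt.η A → tt.η P ≫ Fp₂ = p₂ ≫ tt.η D →
      tt.η A ≫ Ff = f ≫ tt.η B → tt.η D ≫ Fg = g ≫ tt.η B →
      IsPullback Fp₁ Fp₂ Ff Fg

/-- `h` is a trivial extension: the naturality square of the unit at `h` is a pullback. -/
def IsTrivialExt (zc : ZeroClass C) (tt : ZTorsionTheory zc) {X Y : C} (h : X ⟶ Y) : Prop :=
  ∃ Fh : tt.fObj X ⟶ tt.fObj Y, tt.η X ≫ Fh = h ≫ tt.η Y ∧
    IsPullback (tt.η X) h Fh (tt.η Y)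

/-- A full, replete, reflective subcategory, presented by its reflection data. -/
structure ReflectiveSub (C : Type u) [Category.{v} C] where
  carrier : Set C
  repl : ∀ {A B : C}, A ∈ carrier → (A ≅ B) → B ∈ carrier
  obj : C → C
  mem : ∀ A : C, obj A ∈ carrier
  η : ∀ A : C, A ⟶ obj A
  univ : ∀ {A W : C}, W ∈ carrier → ∀ g : A ⟶ W, ∃! g' : obj A ⟶ W, η A ≫ g' = g

/-- The data exhibiting a class of zero objects as terminal. -/
structure TerminalData (zc : ZeroClass C) where
  V : C → C
  v : ∀ A : C, A ⟶ V A
  V_mem : ∀ A : C, V A ∈ zc.carrier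
  fac : ∀ {A Z : C} (χ : A ⟶ Z), Z ∈ zc.carrier → ∃ φ : Z ⟶ V A, χ ≫ φ = v A

/-- A regular category: finite limits, coequalizers of kernel pairs, and pullback-stable
regular epimorphisms. -/
structure IsRegularCategory (C : Type u) [Category.{v} C] [HasFiniteLimits C] : Prop where
  kernelPair_coeq : ∀ {A B : C} (f : A ⟶ B),
    HasCoequalizer (pullback.fst f f) (pullback.snd f f)
  regularEpi_stable : ∀ {X Y Z : C} (f : X ⟶ Z) (g : Y ⟶ Z),
    Nonempty (RegularEpi f) → Nonempty (RegularEpi (pullback.snd f g))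

/-- A protomodular category. -/
structure IsProtomodular (C : Type u) [Category.{v} C] : Prop where
  hasSplitPullbacks : ∀ {A B X : C} (f : A ⟶ B) (p : X ⟶ B) (s : B ⟶ X),
    s ≫ p = 𝟙 B → HasPullback p f
  split_jointly_extremal : ∀ {A B X Y : C} (f : A ⟶ B) (p : X ⟶ B) (s : B ⟶ X)
      (q : Y ⟶ A) (t : A ⟶ Y) (g : Y ⟶ X),
      s ≫ p = 𝟙 B → t ≫ q = 𝟙 A → IsPullback g q p f →
      ∀ {M : C} (m : M ⟶ X), Mono m → (∃ g' : Y ⟶ M, g' ≫ m = g) →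
        (∃ s' : B ⟶ M, s' ≫ m = s) → IsIso m

/-- An internal equivalence relation given by a jointly monic pair. -/
structure IsEquivRelationPair {R A : C} (r₁ r₂ : R ⟶ A) : Prop where
  jointly_mono : ∀ {W : C} (f g : W ⟶ R), f ≫ r₁ = g ≫ r₁ → f ≫ r₂ = g ≫ r₂ → f = g
  refl : ∃ d : A ⟶ R, d ≫ r₁ = 𝟙 A ∧ d ≫ r₂ = 𝟙 A
  symm : ∃ s : R ⟶ R, s ≫ r₁ = r₂ ∧ s ≫ r₂ = r₁
  trans : ∀ {W : C} (f g : W ⟶ R), f ≫ r₂ = g ≫ r₁ →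
    ∃ h : W ⟶ R, h ≫ r₁ = f ≫ r₁ ∧ h ≫ r₂ = g ≫ r₂

/-- A Barr-exact category: regular and every internal equivalence relation is effective. -/
structure IsBarrExact (C : Type u) [Category.{v} C] [HasFiniteLimits C]
    extends IsRegularCategory C : Prop where
  equivRel_effective : ∀ {R A : C} (r₁ r₂ : R ⟶ A), IsEquivRelationPair r₁ r₂ →
    ∃ (B : C) (q : A ⟶ B), IsPullback r₁ r₂ q q

/-- if `m` is a monomorphism and `f ≫ m` lies in the ideal `N_𝒵`,
then so does `f`. -/
theorem inIdeal_of_comp_mono (zc : ZeroClass C) {A B D : C} (f : A ⟶ B) (m : B ⟶ D)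
    (hm : Mono m) (h : InIdeal zc (f ≫ m)) : InIdeal zc f := by
  obtain ⟨W, g, h, hW, hgh⟩ := h
  have := zc.ε_mono B
  obtain ⟨φ, hφ, -⟩ := zc.lift (zc.ε B ≫ m) h (zc.zpart_mem B) hW inferInstance
  refine ⟨zc.zpart B, g ≫ φ, zc.ε B, zc.zpart_mem B, ?_⟩
  rw [← cancel_mono m, ← hgh, ← hφ]
  simp only [Category.assoc]
end

section
/- Let C be a category with a fixed class 𝒵 of zero objects. Suppose p : B ⟶ P is a 𝒵-cokernel of f : A ⟶ B, and let p ∘ f = z ∘ χ be a factorization with χ : A ⟶ Z, z : Z ⟶ P and Z in 𝒵 (such a factorization exists since p ∘ f ∈ N_𝒵). Then the commutative square with top f : A ⟶ B, left χ : A ⟶ Z, right p : B ⟶ P and bottom z : Z ⟶ P is a pushout. -/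
open CategoryTheory CategoryTheory.Limits

universe v u

variable {C : Type u} [Category.{v} C]

/-- if `p` is a `𝒵`-cokernel of `f` and `f ≫ p = χ ≫ z` with `Z ∈ 𝒵`,
then the square with top `f`, left `χ`, right `p`, bottom `z` is a pushout. -/
theorem zCokernel_square_isPushout (zc : ZeroClass C) {A B P Z : C} (f : A ⟶ B)
    (p : B ⟶ P) (hp : IsZCokernel zc p f) (χ : A ⟶ Z) (z : Z ⟶ P)
    (hZ : Z ∈ zc.carrier) (hfact : χ ≫ z = f ≫ p) : IsPushout f χ p z := by
  refine ⟨⟨hfact.symm⟩, ⟨PushoutCocone.IsColimit.mk hfact.symm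
    (fun s => (hp.2 s.inl ⟨Z, χ, s.inr, hZ, s.condition.symm⟩).choose)
    (fun s => (hp.2 s.inl ⟨Z, χ, s.inr, hZ, s.condition.symm⟩).choose_spec.1)
    (fun s => zc.hom_unique hZ _ _)
    (fun s m hm _ => (hp.2 s.inl ⟨Z, χ, s.inr, hZ, s.condition.symm⟩).choose_spec.2 m hm)⟩⟩
end

section
/- Let C be a category with a fixed class 𝒵 of zero objects and f : A ⟶ B a morphism. If k : K ⟶ A is a 𝒵-kernel of f and q : A ⟶ Q is a 𝒵-cokernel of k, then k is a 𝒵-kernel of q. -/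
open CategoryTheory CategoryTheory.Limits

universe v u

variable {C : Type u} [Category.{v} C]

/-- every `𝒵`-kernel is the `𝒵`-kernel of its `𝒵`-cokernel. -/
theorem isZKernel_of_zCokernel (zc : ZeroClass C) {K A B Q : C} (f : A ⟶ B) (k : K ⟶ A)
    (q : A ⟶ Q) (hk : IsZKernel zc k f) (hq : IsZCokernel zc q k) :
    IsZKernel zc k q := by
  obtain ⟨φ, hφ, -⟩ := hq.2 f hk.1
  refine ⟨hq.1, fun e ⟨W, g, h, hW, hgh⟩ => hk.2 e ⟨W, g, h ≫ φ, hW, ?_⟩⟩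
  rw [← hφ, ← Category.assoc, hgh, Category.assoc]
end

section
/- Let C be a category with a fixed class 𝒵 of zero objects. If q : X ⟶ Q is a 𝒵-cokernel of the identity morphism on X, then the canonical monomorphism ε_Q : Z(Q) ⟶ Q is an isomorphism; in particular Q belongs to 𝒵. -/
open CategoryTheory CategoryTheory.Limits

universe v u

variable {C : Type u} [Category.{v} C]

/-- if `q : X ⟶ Q` is a `𝒵`-cokernel of the identity, then the canonical
monomorphism `ε_Q : Z(Q) ⟶ Q` is an isomorphism; in particular `Q` belongs to `𝒵`. -/
theorem zCokernel_id_mem_zeroClass (zc : ZeroClass C) {X Q : C} (q : X ⟶ Q)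
    (hq : IsZCokernel zc q (𝟙 X)) : IsIso (zc.ε Q) ∧ Q ∈ zc.carrier := by
  obtain ⟨⟨W, g, h, hW, hgh⟩, huniv⟩ := hq
  rw [Category.id_comp] at hgh
  obtain ⟨φ, hφ, -⟩ := zc.lift (zc.ε Q) h (zc.zpart_mem Q) hW (zc.ε_mono Q)
  have hfac : (g ≫ φ) ≫ zc.ε Q = q := by rw [Category.assoc, hφ, hgh]
  obtain ⟨ψ, hψ, -⟩ := huniv (g ≫ φ)
    ⟨zc.zpart Q, 𝟙 X ≫ g ≫ φ, 𝟙 _, zc.zpart_mem Q, Category.comp_id _⟩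
  have hψε : ψ ≫ zc.ε Q = 𝟙 Q :=
    (huniv q ⟨W, g, h, hW, by rw [Category.id_comp, hgh]⟩).unique
      (by rw [← Category.assoc, hψ, hfac]) (Category.comp_id q)
  have hεψ : zc.ε Q ≫ ψ = 𝟙 (zc.zpart Q) := zc.hom_unique (zc.zpart_mem Q) _ _
  exact ⟨⟨ψ, hεψ, hψε⟩, zc.repl (zc.zpart_mem Q) ⟨zc.ε Q, ψ, hεψ, hψε⟩⟩
end

section
/- Let C be a category with a fixed class 𝒵 of zero objects. For every object X of C, the identity morphism on X admits a 𝒵-cokernel if and only if X has a maximum quotient in 𝒵. -/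
open CategoryTheory CategoryTheory.Limits

universe v u

variable {C : Type u} [Category.{v} C]

/-- the identity of `X` admits a `𝒵`-cokernel iff `X` has a maximum
quotient in `𝒵`. -/
theorem zCokernel_id_iff_maxQuotient (zc : ZeroClass C) (X : C) :
    (∃ (Q : C) (q : X ⟶ Q), IsZCokernel zc q (𝟙 X)) ↔
      ∃ (M : C) (x : X ⟶ M), IsMaxQuotient zc x := by
  constructor
  · rintro ⟨Q, q, ⟨W, g, h, hW, hq⟩, hu⟩
    refine ⟨W, g, hW, fun {Z} z hZ => ?_⟩
    obtain ⟨φ, hφ, -⟩ := hu z ⟨Z, z, 𝟙 Z, hZ, by simp⟩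
    refine ⟨h ≫ φ, ?_⟩
    rw [← Category.assoc, hq, Category.id_comp, hφ]
  · rintro ⟨M, x, hM, hx⟩
    refine ⟨M, x, ⟨M, x, 𝟙 M, hM, by simp⟩, ?_⟩
    rintro P p ⟨W, g, h, hW, hp⟩
    obtain ⟨φ, hφ⟩ := hx g hW
    refine ⟨φ ≫ h, ?_, fun ψ _ => zc.hom_unique hM _ _⟩
    change x ≫ φ ≫ h = p
    rw [← Category.assoc, hφ, hp, Category.id_comp]
end

section
/- Let C be a category with pushouts and a fixed class 𝒵 of zero objects. For an object X of C, every morphism f : X ⟶ Y admits a 𝒵-cokernel if and only if X has a maximum quotient in 𝒵. Moreover, when x : X ⟶ M(X) is a maximum quotient of X in 𝒵, the pushout of x along f is a 𝒵-cokernel of f. -/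
open CategoryTheory CategoryTheory.Limits

universe v u

variable {C : Type u} [Category.{v} C]

/-- If `q = g ≫ h` is a `𝒵`-cokernel of the identity, with `g` landing in `𝒵`, then `g` is a
maximum quotient. -/
theorem exists_isMaxQuotient_of_isZCokernel_id (zc : ZeroClass C) {X Q : C} {q : X ⟶ Q}
    (hq : IsZCokernel zc q (𝟙 X)) : ∃ (M : C) (x : X ⟶ M), IsMaxQuotient zc x := by
  obtain ⟨⟨W, g, h, hW, hgh⟩, hu⟩ := hq
  refine ⟨W, g, hW, fun {Z} z hZ => ?_⟩
  obtain ⟨φ, hφ, -⟩ := hu z ⟨Z, z, 𝟙 Z, hZ, by simp⟩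
  rw [Category.id_comp] at hgh
  exact ⟨h ≫ φ, by rw [← Category.assoc, hgh, hφ]⟩

/-- The pushout of a maximum quotient along `f` is a `𝒵`-cokernel of `f`. -/
theorem IsMaxQuotient.isZCokernel_pushout_inr [HasPushouts C] {zc : ZeroClass C} {X M : C}
    {x : X ⟶ M} (hx : IsMaxQuotient zc x) {Y : C} (f : X ⟶ Y) :
    IsZCokernel zc (pushout.inr x f) f := by
  refine ⟨⟨M, x, pushout.inl x f, hx.1, pushout.condition⟩, ?_⟩
  rintro P p ⟨W, g, h, hW, hgh⟩
  obtain ⟨φ, hφ⟩ := hx.2 g hW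
  refine ⟨pushout.desc (φ ≫ h) p (by rw [← Category.assoc, hφ, hgh]),
    pushout.inr_desc _ _ _, fun ψ hψ => ?_⟩
  apply pushout.hom_ext
  · exact zc.hom_unique hx.1 _ _
  · rw [pushout.inr_desc]
    exact hψ

/-- in a category with pushouts, every morphism out of `X` admits a
`𝒵`-cokernel iff `X` has a maximum quotient in `𝒵`; moreover, the pushout of a maximum
quotient `x : X ⟶ M(X)` along `f : X ⟶ Y` is a `𝒵`-cokernel of `f`. -/
theorem zCokernel_iff_maxQuotient_and_pushout [HasPushouts C] (zc : ZeroClass C) (X : C) :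
    ((∀ (Y : C) (f : X ⟶ Y), ∃ (Q : C) (q : Y ⟶ Q), IsZCokernel zc q f) ↔
      ∃ (M : C) (x : X ⟶ M), IsMaxQuotient zc x) ∧
    (∀ {M : C} (x : X ⟶ M), IsMaxQuotient zc x →
      ∀ {Y : C} (f : X ⟶ Y), IsZCokernel zc (pushout.inr x f) f) := by
  refine ⟨⟨fun H => ?_, fun ⟨_, x, hx⟩ _ f => ⟨_, _, hx.isZCokernel_pushout_inr f⟩⟩,
    fun _ hx _ f => hx.isZCokernel_pushout_inr f⟩
  obtain ⟨_, _, hq⟩ := H X (𝟙 X)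
  exact exists_isMaxQuotient_of_isZCokernel_id zc hq
end

section
/- Let C be a category with pushouts and a fixed class 𝒵 of zero objects, and let (𝒯, 𝓕) be a 𝒵-torsion theory in C. Then every morphism f : T ⟶ A whose domain T lies in 𝒯 admits a 𝒵-cokernel. -/
open CategoryTheory CategoryTheory.Limits

universe v u

variable {C : Type u} [Category.{v} C]

/-- The reflection of a torsion object in the torsion-free part is a zero object. -/
theorem ZTorsionTheory.fObj_mem_carrier {zc : ZeroClass C} (tt : ZTorsionTheory zc) {T : C}
    (hT : T ∈ tt.tors) : tt.fObj T ∈ zc.carrier := by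
  obtain ⟨W, g, h, hW, hgh⟩ := tt.hom_triv hT (tt.fMem T) (tt.η T)
  obtain ⟨ψ, hψ, -⟩ := (tt.η_coker T).2 g ⟨W, tt.t T ≫ g, 𝟙 W, hW, Category.comp_id _⟩
  obtain ⟨_, _, huniq⟩ := (tt.η_coker T).2 (tt.η T) (tt.η_coker T).1
  refine zc.repl hW ⟨h, ψ, zc.hom_unique hW _ _, ?_⟩
  rw [huniq (ψ ≫ h) (by simp only [reassoc_of% hψ, hgh]), huniq (𝟙 _) (Category.comp_id _)]

/-- in a category with pushouts, given a `𝒵`-torsion theory, every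
morphism with torsion domain admits a `𝒵`-cokernel. -/
theorem torsion_domain_has_zCokernel [HasPushouts C] (zc : ZeroClass C)
    (tt : ZTorsionTheory zc) {T A : C} (hT : T ∈ tt.tors) (f : T ⟶ A) :
    ∃ (Q : C) (q : A ⟶ Q), IsZCokernel zc q f := by
  have hF := tt.fObj_mem_carrier hT
  refine ⟨pushout f (tt.η T), pushout.inl f (tt.η T),
    ⟨tt.fObj T, tt.η T, pushout.inr f (tt.η T), hF, pushout.condition.symm⟩, ?_⟩
  rintro P p ⟨W, g, h, hW, hgh⟩
  obtain ⟨ψ, hψ, -⟩ := (tt.η_coker T).2 g ⟨W, tt.t T ≫ g, 𝟙 W, hW, Category.comp_id _⟩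
  refine ⟨pushout.desc p (ψ ≫ h) (by rw [reassoc_of% hψ, hgh]), pushout.inl_desc _ _ _, ?_⟩
  intro φ hφ
  apply pushout.hom_ext
  · rw [hφ, pushout.inl_desc]
  · exact zc.hom_unique hF _ _
end

section
/- Let C be a category with a fixed class 𝒵 of zero objects, and let (E, M) be a factorization system on C such that every arrow of E is a 𝒵-cokernel of some morphism. Then every morphism whose domain belongs to 𝒵 belongs to M. -/
open CategoryTheory CategoryTheory.Limits

universe v u

variable {C : Type u} [Category.{v} C]

/-- if `(E, M)` is a factorization system in which every arrow of `E` is a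
`𝒵`-cokernel of some morphism, then every morphism with domain in `𝒵` belongs to `M`. -/
theorem mem_M_of_zero_domain (zc : ZeroClass C) (E M : MorClass C)
    (hfs : IsFactorizationSystem E M)
    (hE : ∀ {A B : C} (e : A ⟶ B), E e → ∃ (W : C) (g : W ⟶ A), IsZCokernel zc e g)
    {Z A : C} (hZ : Z ∈ zc.carrier) (f : Z ⟶ A) : M f := by
  obtain ⟨I, e, m, he, hm, rfl⟩ := hfs.fac f
  obtain ⟨W, g, hg, huniv⟩ := hE e he
  obtain ⟨r, hr, -⟩ := huniv (𝟙 Z) ⟨Z, g, 𝟙 Z, hZ, rfl⟩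
  have hre : r ≫ e = 𝟙 I :=
    (huniv e hg).unique (by rw [← Category.assoc, hr, Category.id_comp]) (Category.comp_id e)
  refine hfs.M_repl m (e ≫ m) ⟨r, e, hre, hr⟩ (Iso.refl A) ?_ hm
  simp [← Category.assoc, hre]
end

section
/- Let C be a regular category with a fixed terminal class 𝒵 of zero objects. Let (E, M) be a factorization system on C which is stable with respect to the class of morphisms inverted by the zero-part functor Z, and in which every arrow of E is a 𝒵-cokernel of some morphism. Define 𝒯 = { T | some morphism T ⟶ Z with Z in 𝒵 belongs to E } and 𝓕 = { F | the morphism v_F : F ⟶ V(F) belongs to M }. Then (𝒯, 𝓕) is a 𝒵-torsion theory on C with 𝒯 ∩ 𝓕 = 𝒵, satisfying Conditions (N) and (M). -/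
open CategoryTheory CategoryTheory.Limits

universe v u

variable {C : Type u} [Category.{v} C]

theorem ZeroClass.exists_lift_ε (zc : ZeroClass C) {W A : C} (hW : W ∈ zc.carrier) (f : W ⟶ A) :
    ∃ r : W ⟶ zc.zpart A, r ≫ zc.ε A = f :=
  (zc.lift (zc.ε A) f (zc.zpart_mem A) hW (zc.ε_mono A)).exists

/-- Opposite morphisms between zero objects are mutually inverse. -/
def ZeroClass.isoOfHoms (zc : ZeroClass C) {W W' : C} (hW : W ∈ zc.carrier)
    (hW' : W' ∈ zc.carrier) (f : W ⟶ W') (g : W' ⟶ W) : W ≅ W' where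
  hom := f
  inv := g
  hom_inv_id := zc.hom_unique hW _ _
  inv_hom_id := zc.hom_unique hW' _ _

theorem ZeroClass.invertedByZ_ε (zc : ZeroClass C) (B : C) : InvertedByZ zc (zc.ε B) := by
  obtain ⟨s, hs⟩ := zc.exists_lift_ε (zc.zpart_mem B) (𝟙 (zc.zpart B))
  exact ⟨zc.ε (zc.zpart B), rfl,
    (zc.isoOfHoms (zc.zpart_mem _) (zc.zpart_mem B) (zc.ε (zc.zpart B)) s).isIso_hom⟩

section Ideal

variable {zc : ZeroClass C}

theorem InIdeal.exists_lift_ε {A B : C} {f : A ⟶ B} (hf : InIdeal zc f) :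
    ∃ r : A ⟶ zc.zpart B, r ≫ zc.ε B = f := by
  obtain ⟨W, g, h, hW, rfl⟩ := hf
  obtain ⟨r, rfl⟩ := zc.exists_lift_ε hW h
  exact ⟨g ≫ r, by simp⟩

theorem InIdeal.comp_left {X A B : C} {f : A ⟶ B} (hf : InIdeal zc f) (g : X ⟶ A) :
    InIdeal zc (g ≫ f) := by
  obtain ⟨W, a, b, hW, rfl⟩ := hf
  exact ⟨W, g ≫ a, b, hW, by simp⟩

theorem InIdeal.comp_right {A B Y : C} {f : A ⟶ B} (hf : InIdeal zc f) (g : B ⟶ Y) :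
    InIdeal zc (f ≫ g) := by
  obtain ⟨W, a, b, hW, rfl⟩ := hf
  exact ⟨W, a, b ≫ g, hW, by simp⟩

theorem inIdeal_of_mem_target {A W : C} (hW : W ∈ zc.carrier) (f : A ⟶ W) : InIdeal zc f :=
  ⟨W, f, 𝟙 W, hW, by simp⟩

theorem inIdeal_of_mem_source {W A : C} (hW : W ∈ zc.carrier) (f : W ⟶ A) : InIdeal zc f :=
  ⟨W, 𝟙 W, f, hW, by simp⟩

/-- An object whose identity is in the ideal is a zero object. -/
theorem mem_carrier_of_inIdeal_id {A : C} (h : InIdeal zc (𝟙 A)) : A ∈ zc.carrier := by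
  obtain ⟨W, g, f, hW, hgf⟩ := h
  exact zc.repl hW ⟨f, g, zc.hom_unique hW _ _, hgf⟩

theorem IsZKernel.mono {K A B : C} {k : K ⟶ A} {f : A ⟶ B} (hk : IsZKernel zc k f) : Mono k where
  right_cancellation g h hgh := by
    refine (hk.2 (h ≫ k) ?_).unique hgh rfl
    rw [Category.assoc]
    exact hk.1.comp_left h

theorem IsZCokernel.epi {A B Q : C} {q : B ⟶ Q} {f : A ⟶ B} (hq : IsZCokernel zc q f) :
    Epi q where
  left_cancellation g h hgh := by
    refine (hq.2 (q ≫ h) ?_).unique hgh rfl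
    rw [← Category.assoc]
    exact hq.1.comp_right h

theorem IsZCokernel.exists_desc_of_inIdeal {A B Q P : C} {q : B ⟶ Q} {f : A ⟶ B}
    (hq : IsZCokernel zc q f) {p : B ⟶ P} (hp : InIdeal zc p) : ∃ φ : Q ⟶ P, q ≫ φ = p :=
  (hq.2 p (hp.comp_left f)).exists

theorem IsZKernel.of_isPullback {K A B : C} {k : K ⟶ A} {r : K ⟶ zc.zpart B} {f : A ⟶ B}
    (h : IsPullback k r f (zc.ε B)) : IsZKernel zc k f := by
  refine ⟨⟨_, r, zc.ε B, zc.zpart_mem B, h.w.symm⟩, fun e he => ?_⟩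
  obtain ⟨s, hs⟩ := he.exists_lift_ε
  have := zc.ε_mono B
  refine ⟨h.lift e s hs.symm, by simp, fun y hy => h.hom_ext (by simp [hy]) ?_⟩
  rw [← cancel_mono (zc.ε B), Category.assoc, ← h.w, reassoc_of% hy, h.lift_snd, hs]

theorem IsZKernel.isPullback {K A B : C} {k : K ⟶ A} {r : K ⟶ zc.zpart B} {f : A ⟶ B}
    (hk : IsZKernel zc k f) (hr : r ≫ zc.ε B = k ≫ f) : IsPullback k r f (zc.ε B) := by
  have := zc.ε_mono B
  have := hk.mono
  refine ⟨⟨hr.symm⟩, ⟨PullbackCone.isLimitAux' _ fun s => ?_⟩⟩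
  have h := (hk.2 s.fst ⟨_, s.snd, zc.ε B, zc.zpart_mem B, s.condition.symm⟩).exists
  refine ⟨h.choose, h.choose_spec, ?_, fun {m} hm _ => ?_⟩
  · change h.choose ≫ r = s.snd
    rw [← cancel_mono (zc.ε B), Category.assoc, hr, ← Category.assoc, h.choose_spec, s.condition]
  · exact (cancel_mono k).1 (hm.trans h.choose_spec.symm)

/-- A `𝒵`-cokernel is the `𝒵`-cokernel of its `𝒵`-kernel. -/
theorem IsZCokernel.of_isZKernel {W K A Q : C} {g : W ⟶ A} {k : K ⟶ A} {q : A ⟶ Q}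
    (hq : IsZCokernel zc q g) (hk : IsZKernel zc k q) : IsZCokernel zc q k := by
  refine ⟨hk.1, fun p hp => hq.2 p ?_⟩
  obtain ⟨a, rfl, -⟩ := hk.2 g hq.1
  rw [Category.assoc]
  exact hp.comp_left a

end Ideal

namespace IsFactorizationSystem

variable {E M : MorClass C} {zc : ZeroClass C}

theorem id_mem_left (hfs : IsFactorizationSystem E M) (A : C) : E (𝟙 A) := by
  obtain ⟨I, e, m, he, hm, hem⟩ := hfs.fac (𝟙 A)
  have hme : m ≫ e = 𝟙 I := (hfs.lift e m he hm e m rfl).unique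
    ⟨by rw [← Category.assoc, hem, Category.id_comp], by rw [Category.assoc, hem, Category.comp_id]⟩
    ⟨Category.comp_id _, Category.id_comp _⟩
  exact hfs.E_repl e (𝟙 A) (Iso.refl A) ⟨m, e, hme, hem⟩ (by simp [hem]) he

/-- If `T` has an `E`-quotient in `𝒵`, then morphisms in `M` reflect membership in the ideal
for morphisms out of `T`. -/
theorem inIdeal_of_comp (hfs : IsFactorizationSystem E M)
    (hE : ∀ {A B : C} (e : A ⟶ B), E e → ∃ (W : C) (g : W ⟶ A), IsZCokernel zc e g)
    {T W X Y : C} {e : T ⟶ W} (hW : W ∈ zc.carrier) (he : E e) {u : T ⟶ X} {m : X ⟶ Y}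
    (hm : M m) (hum : InIdeal zc (u ≫ m)) : InIdeal zc u := by
  obtain ⟨_, _, hcok⟩ := hE e he
  obtain ⟨v, hv⟩ := hcok.exists_desc_of_inIdeal hum
  obtain ⟨d, ⟨hd, -⟩, -⟩ := hfs.lift e m he hm u v hv
  exact ⟨W, e, d, hW, hd⟩

theorem v_mem_right (hfs : IsFactorizationSystem E M) (td : TerminalData zc) {A F : C}
    (f : A ⟶ F) {m : F ⟶ td.V A} (hm : M m) : M (td.v F) := by
  obtain ⟨φ, hφ⟩ := td.fac m (td.V_mem A)
  obtain ⟨ψ, -⟩ := td.fac (f ≫ td.v F) (td.V_mem F)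
  refine hfs.M_repl m (td.v F) (Iso.refl F)
    (zc.isoOfHoms (td.V_mem A) (td.V_mem F) φ ψ) ?_ hm
  simp [ZeroClass.isoOfHoms, hφ]

theorem v_mem_right_of_mem_carrier (hfs : IsFactorizationSystem E M) (td : TerminalData zc)
    (hE : ∀ {A B : C} (e : A ⟶ B), E e → ∃ (W : C) (g : W ⟶ A), IsZCokernel zc e g)
    {W : C} (hW : W ∈ zc.carrier) : M (td.v W) := by
  obtain ⟨I, e, m, he, hm, hem⟩ := hfs.fac (td.v W)
  obtain ⟨_, _, hcok⟩ := hE e he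
  obtain ⟨s, hs⟩ := hcok.exists_desc_of_inIdeal (inIdeal_of_mem_source hW (𝟙 W))
  have := hcok.epi
  have hse : s ≫ e = 𝟙 I := by
    rw [← cancel_epi e, ← Category.assoc, hs, Category.id_comp, Category.comp_id]
  exact hfs.M_repl m (td.v W) ⟨s, e, hse, hs⟩ (Iso.refl _) (by simp [← hem, reassoc_of% hse]) hm

theorem exists_isZKernel_of_mem_left [HasFiniteLimits C]
    (hstable : StableAlong E (fun _ _ h => InvertedByZ zc h)) {A B : C} {e : A ⟶ B} (he : E e) :
    ∃ (K : C) (k : K ⟶ A), IsZKernel zc k e ∧ ∃ (W : C) (r : K ⟶ W), W ∈ zc.carrier ∧ E r :=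
  ⟨pullback e (zc.ε B), pullback.fst _ _, .of_isPullback (.of_hasPullback _ _), _, _,
    zc.zpart_mem B, hstable _ _ _ _ (.of_hasPullback _ _) he (zc.invertedByZ_ε B)⟩

theorem exists_torsion_sequence [HasFiniteLimits C] (hfs : IsFactorizationSystem E M)
    (td : TerminalData zc) (hstable : StableAlong E (fun _ _ h => InvertedByZ zc h))
    (hE : ∀ {A B : C} (e : A ⟶ B), E e → ∃ (W : C) (g : W ⟶ A), IsZCokernel zc e g) (A : C) :
    ∃ (T F : C) (t : T ⟶ A) (η : A ⟶ F),
      (∃ (W : C) (e : T ⟶ W), W ∈ zc.carrier ∧ E e) ∧ M (td.v F) ∧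
      IsZKernel zc t η ∧ IsZCokernel zc η t := by
  obtain ⟨F, η, m, hη, hm, -⟩ := hfs.fac (td.v A)
  obtain ⟨T, t, ht, hT⟩ := exists_isZKernel_of_mem_left hstable hη
  obtain ⟨_, _, hcok⟩ := hE η hη
  exact ⟨T, F, t, η, hT, hfs.v_mem_right td η hm, ht, hcok.of_isZKernel ht⟩

theorem condN [HasFiniteLimits C] (hfs : IsFactorizationSystem E M)
    (hstable : StableAlong E (fun _ _ h => InvertedByZ zc h))
    (hE : ∀ {A B : C} (e : A ⟶ B), E e → ∃ (W : C) (g : W ⟶ A), IsZCokernel zc e g)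
    (tt : ZTorsionTheory zc)
    (htors : tt.tors = {T : C | ∃ (W : C) (e : T ⟶ W), W ∈ zc.carrier ∧ E e}) :
    CondN zc tt := by
  intro A B K f k hk
  obtain ⟨I, e, m, he, hm, rfl⟩ := hfs.fac f
  obtain ⟨L, l, hl, hL⟩ := exists_isZKernel_of_mem_left hstable he
  have hLtors : L ∈ tt.tors := by rw [htors]; exact hL
  obtain ⟨W, r, hW, hr⟩ : ∃ (W : C) (r : tt.tObj K ⟶ W), W ∈ zc.carrier ∧ E r := by
    have := tt.tMem K
    rwa [htors] at this
  have := hk.mono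
  have := (tt.t_ker K).mono
  refine ⟨I, e, hfs.inIdeal_of_comp hE hW hr hm ?_, fun x hx => ?_⟩
  · simpa using hk.1.comp_left (tt.t K)
  · obtain ⟨x', hx', -⟩ := hl.2 x hx
    obtain ⟨l', hl', -⟩ := hk.2 l (by simpa using hl.1.comp_right m)
    obtain ⟨l'', hl'', -⟩ := (tt.t_ker K).2 l' (tt.hom_triv hLtors (tt.fMem K) _)
    have hfac : (x' ≫ l'') ≫ tt.t K ≫ k = x := by
      rw [Category.assoc, reassoc_of% hl'', hl', hx']
    exact ⟨x' ≫ l'', hfac, fun y hy => by rw [← cancel_mono (tt.t K ≫ k), hfac]; exact hy⟩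

/-- The `𝒵`-cokernel of a morphism from an object with an `E`-quotient in `𝒵` belongs to `E`. -/
theorem isZCokernel_mem_left (hfs : IsFactorizationSystem E M)
    (hE : ∀ {A B : C} (e : A ⟶ B), E e → ∃ (W : C) (g : W ⟶ A), IsZCokernel zc e g)
    {T W A Q : C} {e : T ⟶ W} (hW : W ∈ zc.carrier) (he : E e) {k : T ⟶ A} {q : A ⟶ Q}
    (hq : IsZCokernel zc q k) : E q := by
  obtain ⟨I, e', m, he', hm, rfl⟩ := hfs.fac q
  obtain ⟨d, hd, -⟩ := hq.2 e' (hfs.inIdeal_of_comp hE hW he hm (by simpa using hq.1))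
  obtain ⟨_, _, hcok⟩ := hE e' he'
  have := hcok.epi
  have := hq.epi
  have hmd : m ≫ d = 𝟙 I := by
    rw [← cancel_epi e', ← Category.assoc, hd, Category.comp_id]
  have hdm : d ≫ m = 𝟙 Q := by
    rw [← cancel_epi (e' ≫ m), ← Category.assoc, hd, Category.comp_id]
  exact hfs.E_repl e' (e' ≫ m) (Iso.refl A) ⟨m, d, hmd, hdm⟩ (by simp) he'

/-- All `E`-quotients in `𝒵` of an object are isomorphic to its torsion-free quotient,
provided that the object is torsion. -/
theorem nonempty_fObj_iso
    (hE : ∀ {A B : C} (e : A ⟶ B), E e → ∃ (W : C) (g : W ⟶ A), IsZCokernel zc e g)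
    (tt : ZTorsionTheory zc) {T W : C} (hT : T ∈ tt.tors) {e : T ⟶ W} (hW : W ∈ zc.carrier)
    (he : E e) : Nonempty (tt.fObj T ≅ W) := by
  obtain ⟨_, _, hcok⟩ := hE e he
  obtain ⟨a, ha⟩ := hcok.exists_desc_of_inIdeal (tt.hom_triv hT (tt.fMem T) (tt.η T))
  obtain ⟨b, hb⟩ := (tt.η_coker T).exists_desc_of_inIdeal (inIdeal_of_mem_target hW e)
  have := (tt.η_coker T).epi
  refine ⟨⟨b, a, ?_, zc.hom_unique hW _ _⟩⟩
  rw [← cancel_epi (tt.η T), reassoc_of% hb, ha, Category.comp_id]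

theorem condM (hfs : IsFactorizationSystem E M)
    (hstable : StableAlong E (fun _ _ h => InvertedByZ zc h))
    (hE : ∀ {A B : C} (e : A ⟶ B), E e → ∃ (W : C) (g : W ⟶ A), IsZCokernel zc e g)
    (tt : ZTorsionTheory zc)
    (htors : tt.tors = {T : C | ∃ (W : C) (e : T ⟶ W), W ∈ zc.carrier ∧ E e}) :
    CondM zc tt := by
  intro T A Q k q hT hk hq
  obtain ⟨W, e, hW, he⟩ := htors ▸ hT
  obtain ⟨r, hr⟩ := hk.1.exists_lift_ε
  exact nonempty_fObj_iso hE tt hT (zc.zpart_mem Q)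
    (hstable _ _ _ _ (hk.isPullback hr) (hfs.isZCokernel_mem_left hE hW he hq)
      (zc.invertedByZ_ε Q))

/-- The `𝒵`-torsion theory induced by a factorization system. -/
noncomputable def torsionTheory [HasFiniteLimits C] (hfs : IsFactorizationSystem E M)
    (td : TerminalData zc) (hstable : StableAlong E (fun _ _ h => InvertedByZ zc h))
    (hE : ∀ {A B : C} (e : A ⟶ B), E e → ∃ (W : C) (g : W ⟶ A), IsZCokernel zc e g) :
    ZTorsionTheory zc :=
  have hom_triv : ∀ {T F : C}, (∃ (W : C) (e : T ⟶ W), W ∈ zc.carrier ∧ E e) → M (td.v F) →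
      ∀ f : T ⟶ F, InIdeal zc f := fun ⟨_, _, hW, he⟩ hF _ =>
    hfs.inIdeal_of_comp hE hW he hF (inIdeal_of_mem_target (td.V_mem _) _)
  have seq := hfs.exists_torsion_sequence td hstable hE
  { tors := {T : C | ∃ (W : C) (e : T ⟶ W), W ∈ zc.carrier ∧ E e}
    torsFree := {F : C | M (td.v F)}
    tors_repl := fun ⟨W, e, hW, he⟩ i =>
      ⟨W, i.inv ≫ e, hW, hfs.E_repl e _ i (Iso.refl W) (by simp) he⟩
    torsFree_repl := fun {A _} hA i => hfs.v_mem_right td i.hom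
      (hfs.M_repl (td.v A) (i.inv ≫ td.v A) i (Iso.refl _) (by simp) hA)
    inter := Set.ext fun W =>
      ⟨fun hW => ⟨⟨W, 𝟙 W, hW, hfs.id_mem_left W⟩, hfs.v_mem_right_of_mem_carrier td hE hW⟩,
        fun hW => mem_carrier_of_inIdeal_id (hom_triv hW.1 hW.2 (𝟙 W))⟩
    hom_triv := hom_triv
    tObj := fun A => (seq A).choose
    fObj := fun A => (seq A).choose_spec.choose
    t := fun A => (seq A).choose_spec.choose_spec.choose
    η := fun A => (seq A).choose_spec.choose_spec.choose_spec.choose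
    tMem := fun A => (seq A).choose_spec.choose_spec.choose_spec.choose_spec.1
    fMem := fun A => (seq A).choose_spec.choose_spec.choose_spec.choose_spec.2.1
    t_ker := fun A => (seq A).choose_spec.choose_spec.choose_spec.choose_spec.2.2.1
    η_coker := fun A => (seq A).choose_spec.choose_spec.choose_spec.choose_spec.2.2.2 }

end IsFactorizationSystem

/-- in a regular category with a terminal class `𝒵` of zero objects, a
factorization system `(E, M)` stable along the morphisms inverted by `Z`, whose
`E`-arrows are `𝒵`-cokernels, induces a `𝒵`-torsion theory (with `𝒯 ∩ 𝓕 = 𝒵`)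
satisfying Conditions (N) and (M). -/
theorem factorizationSystem_gives_torsionTheory [HasFiniteLimits C]
    (hreg : IsRegularCategory C) (zc : ZeroClass C) (td : TerminalData zc)
    (E M : MorClass C) (hfs : IsFactorizationSystem E M)
    (hstable : StableAlong E (fun _ _ h => InvertedByZ zc h))
    (hE : ∀ {A B : C} (e : A ⟶ B), E e → ∃ (W : C) (g : W ⟶ A), IsZCokernel zc e g) :
    ∃ tt : ZTorsionTheory zc,
      tt.tors = {T : C | ∃ (Z : C) (e : T ⟶ Z), Z ∈ zc.carrier ∧ E e} ∧
      tt.torsFree = {F : C | M (td.v F)} ∧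
      CondN zc tt ∧ CondM zc tt := by
  exact ⟨hfs.torsionTheory td hstable hE, rfl, rfl, hfs.condN hstable hE _ rfl,
    hfs.condM hstable hE _ rfl⟩
end

section
/- Let C be a regular category and 𝓕 a full, replete, reflective subcategory of C whose reflection unit components η_A : A ⟶ F(A) are regular epimorphisms. Then 𝓕 is closed under subobjects in C: if s : S ⟶ A is a monomorphism and A belongs to 𝓕, then S belongs to 𝓕 (equivalently, η_S is an isomorphism). -/
open CategoryTheory CategoryTheory.Limits

universe v u

variable {C : Type u} [Category.{v} C]

/-- a full, replete, regular-epi-reflective subcategory of a regular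
category is closed under subobjects. -/
theorem reflective_closed_under_subobjects [HasFiniteLimits C]
    (hreg : IsRegularCategory C) (R : ReflectiveSub C)
    (hunits : ∀ A : C, Nonempty (RegularEpi (R.η A)))
    {S A : C} (s : S ⟶ A) (hs : Mono s) (hA : A ∈ R.carrier) :
    S ∈ R.carrier ∧ IsIso (R.η S) := by
  obtain ⟨g, hg, -⟩ := R.univ hA s
  have : Mono (R.η S ≫ g) := hg ▸ hs
  have : Mono (R.η S) := mono_of_mono (R.η S) g
  have : IsRegularEpi (R.η S) := ⟨hunits S⟩
  have hiso : IsIso (R.η S) := isIso_of_mono_of_strongEpi (R.η S)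
  exact ⟨R.repl (R.mem S) (asIso (R.η S)).symm, hiso⟩
end

section
/- Let C be a regular protomodular category with a fixed class 𝒵 of zero objects, and let (𝒯, 𝓕) be a 𝒵-torsion theory in C satisfying Condition (M'). Let F : C ⟶ 𝓕 be the associated reflector with unit η. Then: every component η_A is a 𝒵-cokernel; F(Z) = Z for every object Z of 𝒵; and for every morphism f : A ⟶ F(B) between objects of 𝓕 which is inverted by Z, the image under F of the pullback f*(η_B) of η_B along f is an isomorphism. -/
open CategoryTheory CategoryTheory.Limits

universe v u

variable {C : Type u} [Category.{v} C]

section HelperLemmas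

variable {zc : ZeroClass C}

lemma IsRegularCategory.toRegular [HasFiniteLimits C] (h : IsRegularCategory C) :
    CategoryTheory.Regular C where
  hasCoequalizer_of_isKernelPair {X Y Z f g₁ g₂} hk := by
    have := h.kernelPair_coeq f
    let i := hk.isoPullback
    have h₁ : i.inv ≫ g₁ = pullback.fst f f := hk.isoPullback_inv_fst
    have h₂ : i.inv ≫ g₂ = pullback.snd f f := hk.isoPullback_inv_snd
    exact hasColimit_of_iso (F := parallelPair (pullback.fst f f) (pullback.snd f f))
      (parallelPair.ext i (Iso.refl _) (by simp [i]) (by simp [i]))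
  regularEpiIsStableUnderBaseChange := by
    refine .mk' fun X Y S f g _ hg => ?_
    have : IsRegularEpi (pullback.snd g f) := ⟨h.regularEpi_stable g f hg.regularEpi⟩
    have e : pullback.fst f g = (pullbackSymmetry f g).hom ≫ pullback.snd g f := by simp
    rw [e]
    exact ((MorphismProperty.regularEpi C).cancel_left_of_respectsIso _ _).2 this

lemma ZeroClass.exists_factor_zpart (zc : ZeroClass C) {Z A : C} (hZ : Z ∈ zc.carrier)
    (z : Z ⟶ A) : ∃ φ : Z ⟶ zc.zpart A, φ ≫ zc.ε A = z :=
  (zc.lift (zc.ε A) z (zc.zpart_mem A) hZ (zc.ε_mono A)).exists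

lemma inIdeal_iff_factors_zpart {A B : C} (f : A ⟶ B) :
    InIdeal zc f ↔ ∃ g : A ⟶ zc.zpart B, g ≫ zc.ε B = f := by
  constructor
  · rintro ⟨W, g, h, hW, rfl⟩
    obtain ⟨φ, rfl⟩ := zc.exists_factor_zpart hW h
    exact ⟨g ≫ φ, by simp⟩
  · rintro ⟨g, hg⟩
    exact ⟨_, g, _, zc.zpart_mem B, hg⟩

lemma InIdeal.of_comp_mono {A M Q : C} {e : A ⟶ M} {m : M ⟶ Q} [Mono m]
    (h : InIdeal zc (e ≫ m)) : InIdeal zc e := by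
  obtain ⟨W, g, w, hW, hgw⟩ := h
  have := zc.ε_mono M
  obtain ⟨φ, hφ, -⟩ := zc.lift (zc.ε M ≫ m) w (zc.zpart_mem M) hW (mono_comp _ _)
  refine ⟨_, g ≫ φ, zc.ε M, zc.zpart_mem M, ?_⟩
  rw [← cancel_mono m, ← hgw, ← hφ]
  simp

lemma IsZCokernel.strongEpi [HasFiniteLimits C] {A B Q : C} {q : B ⟶ Q} {f : A ⟶ B}
    (h : IsZCokernel zc q f) : StrongEpi q := by
  have : ExtremalEpi q := .mk_of_hasEqualizers _ fun M e m hem _ => by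
    obtain ⟨ψ, hψ, -⟩ := h.2 e (InIdeal.of_comp_mono (m := m) (by simpa [hem] using h.1))
    have hψm : ψ ≫ m = 𝟙 Q :=
      (h.2 q h.1).unique (by rw [← Category.assoc, hψ, hem]) (Category.comp_id q)
    exact ⟨ψ, by rw [← cancel_mono m, Category.assoc, hψm]; simp, hψm⟩
  exact (extremalEpi_iff_strongEpi_of_hasPullbacks q).1 this

lemma IsZKernel.exists_isPullback {K A B : C} {k : K ⟶ A} {f : A ⟶ B} (h : IsZKernel zc k f) :
    ∃ χ : K ⟶ zc.zpart B, IsPullback χ k (zc.ε B) f := by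
  obtain ⟨χ, hχ⟩ := (inIdeal_iff_factors_zpart _).1 h.1
  have := zc.ε_mono B
  refine ⟨χ, ⟨⟨hχ⟩, ⟨PullbackCone.IsLimit.mk _ (fun s => (h.2 s.snd
    ((inIdeal_iff_factors_zpart _).2 ⟨s.fst, s.condition⟩)).choose) (fun s => ?_) (fun s => ?_)
    (fun s m _ hm => ?_)⟩⟩⟩
  all_goals
    have hs := (h.2 s.snd ((inIdeal_iff_factors_zpart _).2 ⟨s.fst, s.condition⟩)).choose_spec
  · rw [← cancel_mono (zc.ε B), Category.assoc, hχ, ← Category.assoc, hs.1, s.condition]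
  · exact hs.1
  · exact hs.2 m hm

/-- A strong quotient of a zero object is a zero object. -/
lemma ZeroClass.mem_of_strongEpi (zc : ZeroClass C) {W L : C} (hW : W ∈ zc.carrier)
    (p : W ⟶ L) [StrongEpi p] : L ∈ zc.carrier := by
  obtain ⟨φ, hφ⟩ := zc.exists_factor_zpart hW p
  have := zc.ε_mono L
  have : StrongEpi (φ ≫ zc.ε L) := hφ ▸ inferInstance
  have := strongEpi_of_strongEpi φ (zc.ε L)
  have := isIso_of_mono_of_strongEpi (zc.ε L)
  exact zc.repl (zc.zpart_mem L) (asIso (zc.ε L))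

/-- Morphisms in opposite directions between zero objects are mutually inverse. -/
lemma ZeroClass.isIso_of_hom (zc : ZeroClass C) {W W' : C} (hW : W ∈ zc.carrier)
    (hW' : W' ∈ zc.carrier) (a : W ⟶ W') (b : W' ⟶ W) : IsIso a :=
  ⟨b, zc.hom_unique hW _ _, zc.hom_unique hW' _ _⟩

namespace ZTorsionTheory

variable (tt : ZTorsionTheory zc)

lemma exists_factor_η {A B : C} (hB : B ∈ tt.torsFree) (g : A ⟶ B) :
    ∃ φ : tt.fObj A ⟶ B, tt.η A ≫ φ = g :=
  ((tt.η_coker A).2 g (tt.hom_triv (tt.tMem A) hB _)).exists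

/-- A torsion-free strong quotient of a torsion object is a zero object. -/
lemma mem_carrier_of_strongEpi {T L : C} (hT : T ∈ tt.tors) (hL : L ∈ tt.torsFree)
    (r : T ⟶ L) [StrongEpi r] : L ∈ zc.carrier := by
  obtain ⟨W, g, h, hW, hgh⟩ := tt.hom_triv hT hL r
  have : StrongEpi (g ≫ h) := hgh ▸ inferInstance
  have := strongEpi_of_strongEpi g h
  exact zc.mem_of_strongEpi hW h

variable [HasFiniteLimits C]

instance strongEpi_η (A : C) : StrongEpi (tt.η A) :=
  (tt.η_coker A).strongEpi

/-- Torsion-free objects are closed under subobjects, and their units are invertible. -/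
lemma isIso_η_of_mono {L X : C} (hX : X ∈ tt.torsFree) (l : L ⟶ X) [Mono l] :
    IsIso (tt.η L) := by
  obtain ⟨ψ, hψ⟩ := tt.exists_factor_η hX l
  have : Mono (tt.η L ≫ ψ) := hψ ▸ inferInstance
  have := mono_of_mono (tt.η L) ψ
  exact isIso_of_mono_of_strongEpi _

lemma mem_torsFree_of_mono {L X : C} (hX : X ∈ tt.torsFree) (l : L ⟶ X) [Mono l] :
    L ∈ tt.torsFree :=
  have := tt.isIso_η_of_mono hX l
  tt.torsFree_repl (tt.fMem L) (asIso (tt.η L)).symm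

end ZTorsionTheory

/-- In a protomodular category, a morphism whose pullback along some `z` is invertible
is a monomorphism. -/
lemma IsProtomodular.mono_of_isIso_pullback [HasFiniteLimits C] (hproto : IsProtomodular C)
    {X A Z L : C} {ψ : X ⟶ A} {z : Z ⟶ A} {l : L ⟶ X} {l' : L ⟶ Z}
    (hL : IsPullback l l' ψ z) [IsIso l'] : Mono ψ := by
  have hK := IsPullback.of_hasPullback ψ ψ
  let s : X ⟶ pullback ψ ψ := pullback.diagonal ψ
  have hs : s ≫ pullback.fst ψ ψ = 𝟙 X := by simp [s]
  have hs' : s ≫ pullback.snd ψ ψ = 𝟙 X := by simp [s]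
  have hpb : IsPullback (l ≫ s) (𝟙 L) (pullback.fst ψ ψ) l := by
    refine IsPullback.of_right (h₁₂ := pullback.snd ψ ψ) (h₂₂ := ψ) ?_ (by simp [hs]) hK.flip
    rw [Category.assoc, hs', Category.comp_id, hL.w]
    refine ⟨⟨by simp [hL.w]⟩, ⟨PullbackCone.IsLimit.mk _ (fun c => c.snd) (fun c => ?_)
      (fun c => by simp) (fun c m _ hm => by simpa using hm)⟩⟩
    have h₁ : c.fst ≫ ψ = (c.snd ≫ l') ≫ z := by simpa using c.condition
    have h₂ : hL.lift c.fst (c.snd ≫ l') h₁ = c.snd := by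
      rw [← cancel_mono l', hL.lift_snd]
    rw [← h₂, hL.lift_fst]
  have : IsIso s := hproto.split_jointly_extremal l (pullback.fst ψ ψ) s (𝟙 L) (𝟙 L) (l ≫ s)
    hs (by simp) hpb s inferInstance ⟨l, rfl⟩ ⟨𝟙 X, by simp⟩
  refine IsKernelPair.mono_of_eq_fst_snd (IsKernelPair.of_hasPullback ψ) ?_
  rw [← cancel_epi s, hs, hs']

end HelperLemmas

/-- in a regular protomodular category, for a `𝒵`-torsion theory
satisfying Condition (M'), every unit component is a `𝒵`-cokernel, the reflection
fixes the zero objects, and the reflector inverts the pullback of a unit along any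
morphism of `𝓕` inverted by `Z`. -/
theorem torsionTheory_gives_reflection [HasFiniteLimits C]
    (hreg : IsRegularCategory C) (hproto : IsProtomodular C)
    (zc : ZeroClass C) (tt : ZTorsionTheory zc) (hM' : CondM' zc tt) :
    (∀ A : C, IsZCokernel zc (tt.η A) (tt.t A)) ∧
    (∀ Z ∈ zc.carrier, IsIso (tt.η Z)) ∧
    (∀ {A B : C} (f : A ⟶ tt.fObj B), A ∈ tt.torsFree → InvertedByZ zc f →
      ∀ {P : C} (f'' : P ⟶ A) (f' : P ⟶ B), IsPullback f'' f' f (tt.η B) →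
        ∀ φ : tt.fObj P ⟶ tt.fObj A, tt.η P ≫ φ = f'' ≫ tt.η A → IsIso φ) := by
  have := hreg.toRegular
  have hη : ∀ Z ∈ zc.carrier, IsIso (tt.η Z) := fun Z hZ =>
    tt.isIso_η_of_mono (tt.inter ▸ hZ : Z ∈ tt.tors ∩ tt.torsFree).2 (𝟙 Z)
  refine ⟨tt.η_coker, hη, ?_⟩
  rintro A B f hA ⟨θ, hθ, _⟩ P f'' f' hP φ hφ
  have hηA := tt.isIso_η_of_mono hA (𝟙 A)
  have := zc.ε_mono A
  obtain ⟨ψ, rfl⟩ : ∃ ψ : tt.fObj P ⟶ A, ψ ≫ tt.η A = φ := ⟨φ ≫ inv (tt.η A), by simp⟩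
  have hψ : tt.η P ≫ ψ = f'' := by
    rw [← cancel_mono (tt.η A), Category.assoc, hφ]
  have hL := IsPullback.of_hasPullback ψ (zc.ε A)
  set l := pullback.fst ψ (zc.ε A)
  set l' := pullback.snd ψ (zc.ε A)
  have hK := IsPullback.of_hasPullback f'' (zc.ε A)
  set k := pullback.fst f'' (zc.ε A)
  set k' := pullback.snd f'' (zc.ε A)
  let r := hL.lift (k ≫ tt.η P) k' (by rw [Category.assoc, hψ, hK.w])
  have hr : IsPullback r k l (tt.η P) :=
    IsPullback.of_right (h₁₂ := l') (h₂₂ := ψ) (by simpa [r, hψ] using hK.flip)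
      (by simp [r]) hL.flip
  have hr' : IsRegularEpi r :=
    Regular.regularEpiIsStableUnderBaseChange.of_isPullback hr.flip
      (show IsRegularEpi (tt.η P) from inferInstance)
  obtain ⟨χ, hχ⟩ := (tt.t_ker B).exists_isPullback
  have hKB : IsPullback (k' ≫ θ) (k ≫ f') (zc.ε (tt.fObj B)) (tt.η B) :=
    (hK.flip.paste_vert hP).of_iso (Iso.refl _) (asIso θ) (Iso.refl _) (Iso.refl _)
      (by simp) (by simp) (by simp [hθ]) (by simp)
  let i := hχ.isoIsPullback _ _ hKB
  have hKT := tt.tors_repl (tt.tMem B) i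
  have hLF := tt.mem_torsFree_of_mono (tt.fMem P) l
  have hLZ := tt.mem_carrier_of_strongEpi hKT hLF r
  obtain ⟨d, -⟩ := tt.exists_factor_η hLF (i.hom ≫ r)
  obtain ⟨j⟩ := hM' B
  have := zc.isIso_of_hom hLZ (zc.zpart_mem A) l' (θ ≫ j.inv ≫ d)
  have := hproto.mono_of_isIso_pullback hL
  have : IsRegularEpi f'' :=
    Regular.regularEpiIsStableUnderBaseChange.of_isPullback hP.flip
      (show IsRegularEpi (tt.η B) from inferInstance)
  have : StrongEpi (tt.η P ≫ ψ) := hψ ▸ inferInstance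
  have := strongEpi_of_strongEpi (tt.η P) ψ
  have := isIso_of_mono_of_strongEpi ψ
  infer_instance
end
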